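/- arXiv:2005.00331 — 3 statements merged into one kernel-verified Lean document; each statement's English description precedes it below -/
import Mathlib

section
/- Let n be a positive integer, let A : ℝ → Matrix (Fin n) (Fin n) ℝ, v : ℝ → (Fin n → ℝ) and λ : ℝ → ℝ be differentiable at t₀, suppose A t is symmetric (A t = (A t)ᵀ) for all t, the eigen-equation A t *ᵥ v t = λ t • v t holds for all t in a neighborhood of t₀, and the eigenvector is normalized, ⟪v t, v t⟫ = 1 for all t in that neighborhood (⟪·,·⟫ the Euclidean inner product on ℝⁿ). Then the derivative of the eigenvalue is given by deriv λ t₀ = ⟪(deriv A t₀) *ᵥ v t₀, v t₀⟫. -/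
open Matrix

attribute [local instance] Matrix.normedAddCommGroup Matrix.normedSpace

theorem HasDerivAt.dotProduct {ι : Type*} [Fintype ι] {u w : ℝ → ι → ℝ} {u' w' : ι → ℝ} {t : ℝ}
    (hu : HasDerivAt u u' t) (hw : HasDerivAt w w' t) :
    HasDerivAt (fun s => u s ⬝ᵥ w s) (u' ⬝ᵥ w t + u t ⬝ᵥ w') t := by
  simp only [_root_.dotProduct, ← Finset.sum_add_distrib]
  exact HasDerivAt.fun_sum fun i _ => (hasDerivAt_pi.1 hu i).mul (hasDerivAt_pi.1 hw i)

theorem HasDerivAt.mulVec {ι κ : Type*} [Fintype ι] [Fintype κ] {M : ℝ → Matrix ι κ ℝ}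
    {M' : Matrix ι κ ℝ} {w : ℝ → κ → ℝ} {w' : κ → ℝ} {t : ℝ}
    (hM : HasDerivAt M M' t) (hw : HasDerivAt w w' t) :
    HasDerivAt (fun s => M s *ᵥ w s) (M' *ᵥ w t + M t *ᵥ w') t :=
  hasDerivAt_pi.2 fun i => HasDerivAt.dotProduct (hasDerivAt_pi.1 hM i) hw

/-- For a symmetric matrix family `A t` with normalized eigenvector family `v t` and
eigenvalue family `λ t`, the derivative of the eigenvalue is
`deriv λ t₀ = ⟪(deriv A t₀) *ᵥ v t₀, v t₀⟫`. -/
theorem deriv_eigenvalue (n : ℕ) (hn : 0 < n)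
    (A : ℝ → Matrix (Fin n) (Fin n) ℝ) (v : ℝ → (Fin n → ℝ)) (lam : ℝ → ℝ) (t₀ : ℝ)
    (hA : DifferentiableAt ℝ A t₀) (hv : DifferentiableAt ℝ v t₀)
    (hlam : DifferentiableAt ℝ lam t₀)
    (hsym : ∀ t, A t = (A t)ᵀ)
    (heig : ∀ᶠ t in nhds t₀, A t *ᵥ v t = lam t • v t)
    (hnorm : ∀ᶠ t in nhds t₀, v t ⬝ᵥ v t = 1) :
    deriv lam t₀ = ((deriv A t₀) *ᵥ v t₀) ⬝ᵥ v t₀ := by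
  have hv' := hv.hasDerivAt
  have hlam_eq : lam =ᶠ[nhds t₀] fun t => (A t *ᵥ v t) ⬝ᵥ v t := by
    filter_upwards [heig, hnorm] with t ht ht'
    rw [ht, smul_dotProduct, ht', smul_eq_mul, mul_one]
  have horth : deriv v t₀ ⬝ᵥ v t₀ = 0 := by
    have h := (hv'.dotProduct hv').unique
      ((hasDerivAt_const t₀ (1 : ℝ)).congr_of_eventuallyEq hnorm)
    rw [dotProduct_comm (v t₀)] at h
    linarith
  have hself : (A t₀ *ᵥ deriv v t₀) ⬝ᵥ v t₀ = deriv v t₀ ⬝ᵥ (A t₀ *ᵥ v t₀) := by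
    rw [dotProduct_mulVec, ← mulVec_transpose, ← hsym]
  rw [hlam_eq.deriv_eq, ((hA.hasDerivAt.mulVec hv').dotProduct hv').deriv, add_dotProduct, hself,
    heig.self_of_nhds, dotProduct_smul, smul_dotProduct, dotProduct_comm (v t₀), horth]
  simp only [add_zero, smul_zero]
  rfl
end

section
/- Let A = V * D * Vᵀ be a real n×n matrix with V orthogonal (V * Vᵀ = 1) and D = diag(λ₁,…,λₙ) diagonal, fix an index j, set λ := λ_j and let v ∈ ℝⁿ be the j-th column of V (so A *ᵥ v = λ • v and ⟪v,v⟫ = 1). Assume λ is a simple eigenvalue, i.e., λᵢ ≠ λ for all i ≠ j. Suppose vectors δv ∈ ℝⁿ, a matrix δA, and a scalar δλ satisfy the linearized eigensystem (A - λ•1) *ᵥ δv = δλ • v - δA *ᵥ v together with the orthogonality constraint ⟪δv, v⟫ = 0. Then δv = -(V * D† * Vᵀ) *ᵥ (δA *ᵥ v), where (D†)ᵢᵢ = 0 if i = j and (D†)ᵢᵢ = 1/(λᵢ - λ) otherwise. -/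
open Matrix

/-- At a simple eigenvalue `λ = λ_j` of `A = V * D * Vᵀ` with unit eigenvector `v`
(the `j`-th column of `V`), the solution `δv` of the linearized eigensystem
`(A - λ•1) *ᵥ δv = δl • v - δA *ᵥ v` with the orthogonality constraint `⟪δv, v⟫ = 0`
is given by `δv = -L† *ᵥ (δA *ᵥ v)` with `L† = V * D† * Vᵀ`. -/
theorem eigenvector_derivative_formula (n : ℕ) (V : Matrix (Fin n) (Fin n) ℝ)
    (lam : Fin n → ℝ) (hV : V * Vᵀ = 1) (j : Fin n)
    (D : Matrix (Fin n) (Fin n) ℝ) (hD : D = Matrix.diagonal lam)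
    (A : Matrix (Fin n) (Fin n) ℝ) (hA : A = V * D * Vᵀ)
    (v : Fin n → ℝ) (hv : v = fun i => V i j)
    (hsimple : ∀ i : Fin n, i ≠ j → lam i ≠ lam j)
    (Ddag : Matrix (Fin n) (Fin n) ℝ)
    (hDdag : Ddag = Matrix.diagonal (fun i => if i = j then 0 else (lam i - lam j)⁻¹))
    (δv : Fin n → ℝ) (δA : Matrix (Fin n) (Fin n) ℝ) (δl : ℝ)
    (hlin : (A - lam j • (1 : Matrix (Fin n) (Fin n) ℝ)) *ᵥ δv = δl • v - δA *ᵥ v)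
    (horth : δv ⬝ᵥ v = 0) :
    δv = -((V * Ddag * Vᵀ) *ᵥ (δA *ᵥ v)) := by
  have hV' : Vᵀ * V = 1 := mul_eq_one_comm.mp hV
  have hvV : Vᵀ *ᵥ v = Pi.single j 1 := by
    have hcol : v = V *ᵥ Pi.single j 1 := by
      rw [hv, mulVec_single_one]; rfl
    rw [hcol, mulVec_mulVec, hV', one_mulVec]
  have hwj : (Vᵀ *ᵥ δv) j = 0 := by
    rw [← horth, hv, dotProduct_comm]
    rfl
  have hdiag : Vᵀ * (A - lam j • (1 : Matrix (Fin n) (Fin n) ℝ))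
      = diagonal (fun i => lam i - lam j) * Vᵀ := by
    have hVA : Vᵀ * A = diagonal lam * Vᵀ := by
      rw [hA, hD, ← Matrix.mul_assoc, ← Matrix.mul_assoc, hV', Matrix.one_mul]
    rw [Matrix.mul_sub, hVA]
    ext i k
    simp [diagonal_mul, sub_mul]
  have hcoord : ∀ i, (lam i - lam j) * (Vᵀ *ᵥ δv) i
      = δl * (Pi.single j 1 : Fin n → ℝ) i - (Vᵀ *ᵥ (δA *ᵥ v)) i := by
    intro i
    have h := congrFun (congrArg (Vᵀ *ᵥ ·) hlin) i
    simp only [mulVec_mulVec _ Vᵀ (A - _), hdiag, mulVec_sub, mulVec_smul, hvV] at h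
    rw [← mulVec_mulVec, mulVec_diagonal] at h
    simpa using h
  have hw : Vᵀ *ᵥ δv = -(Ddag *ᵥ (Vᵀ *ᵥ (δA *ᵥ v))) := by
    ext i
    rw [Pi.neg_apply, hDdag, mulVec_diagonal]
    by_cases hij : i = j
    · subst hij
      simp [hwj]
    · have hne : lam i - lam j ≠ 0 := sub_ne_zero.mpr (hsimple i hij)
      have h := hcoord i
      rw [Pi.single_eq_of_ne hij, mul_zero, zero_sub] at h
      rw [if_neg hij, ← mul_neg, ← h, inv_mul_cancel_left₀ hne]
  calc δv = V *ᵥ (Vᵀ *ᵥ δv) := by rw [mulVec_mulVec, hV, one_mulVec]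
    _ = -((V * Ddag * Vᵀ) *ᵥ (δA *ᵥ v)) := by
      rw [hw, mulVec_neg, ← mulVec_mulVec _ (V * Ddag), ← mulVec_mulVec _ V]
end

section
/- Let e = V * D * Vᵀ be a real n×n matrix with V orthogonal (V * Vᵀ = 1) and D = diag(λ₁,…,λₙ) diagonal, with spectral positive and negative parts e⁺ := V * D⁺ * Vᵀ and e⁻ := V * D⁻ * Vᵀ, where (D⁺)ᵢᵢ = max(λᵢ,0) and (D⁻)ᵢᵢ = min(λᵢ,0). Let μ > 0 and λ' be real parameters (the Lamé parameters) and define the elastic energy E_s(e) := (λ'/2)·(trace e)² + μ·trace(e²), and its tensile and compressive parts E_s⁺(e) := (λ'/2)·(max(trace e, 0))² + μ·trace((e⁺)²) and E_s⁻(e) := (λ'/2)·(min(trace e, 0))² + μ·trace((e⁻)²). Then the elastic energy splits additively: E_s(e) = E_s⁺(e) + E_s⁻(e). -/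
open Matrix

/-- An orthogonal change of basis preserves the trace of the square of a diagonal matrix. -/
theorem trace_orthogonal_conj_diagonal_sq {m : Type*} [Fintype m] [DecidableEq m]
    {V : Matrix m m ℝ} (hV : V * Vᵀ = 1) (d : m → ℝ) :
    Matrix.trace ((V * Matrix.diagonal d * Vᵀ) * (V * Matrix.diagonal d * Vᵀ)) =
      ∑ i, d i ^ 2 := by
  have hV' : Vᵀ * V = 1 := mul_eq_one_comm.mp hV
  have h : (V * Matrix.diagonal d * Vᵀ) * (V * Matrix.diagonal d * Vᵀ) =
      V * (Matrix.diagonal d * Matrix.diagonal d) * Vᵀ := by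
    calc _ = V * Matrix.diagonal d * (Vᵀ * V) * Matrix.diagonal d * Vᵀ := by
          simp only [Matrix.mul_assoc]
      _ = _ := by rw [hV', Matrix.mul_one]; simp only [Matrix.mul_assoc]
  rw [h, Matrix.trace_mul_comm, ← Matrix.mul_assoc, hV', Matrix.one_mul,
    Matrix.diagonal_mul_diagonal, Matrix.trace_diagonal]
  simp only [sq]

/-- The square of a real number is the sum of the squares of its positive and negative parts. -/
theorem sq_eq_max_zero_sq_add_min_zero_sq (x : ℝ) : x ^ 2 = max x 0 ^ 2 + min x 0 ^ 2 := by
  rcases le_total x 0 with h | h <;> simp [h]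

/-- The elastic energy `E_s(e) = (λ'/2)·tr²(e) + μ·tr(e²)` splits additively into its
tensile and compressive parts: `E_s(e) = E_s⁺(e) + E_s⁻(e)`. -/
theorem elastic_energy_splitting (n : ℕ) (V : Matrix (Fin n) (Fin n) ℝ)
    (lam : Fin n → ℝ) (hV : V * Vᵀ = 1)
    (D : Matrix (Fin n) (Fin n) ℝ) (hD : D = Matrix.diagonal lam)
    (e : Matrix (Fin n) (Fin n) ℝ) (he : e = V * D * Vᵀ)
    (Dplus : Matrix (Fin n) (Fin n) ℝ) (hDplus : Dplus = Matrix.diagonal (fun i => max (lam i) 0))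
    (Dminus : Matrix (Fin n) (Fin n) ℝ) (hDminus : Dminus = Matrix.diagonal (fun i => min (lam i) 0))
    (eplus : Matrix (Fin n) (Fin n) ℝ) (heplus : eplus = V * Dplus * Vᵀ)
    (eminus : Matrix (Fin n) (Fin n) ℝ) (heminus : eminus = V * Dminus * Vᵀ)
    (μ lam' : ℝ) (hμ : 0 < μ)
    (Es EsPlus EsMinus : ℝ)
    (hEs : Es = lam' / 2 * (Matrix.trace e) ^ 2 + μ * Matrix.trace (e * e))
    (hEsPlus : EsPlus = lam' / 2 * (max (Matrix.trace e) 0) ^ 2 + μ * Matrix.trace (eplus * eplus))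
    (hEsMinus : EsMinus = lam' / 2 * (min (Matrix.trace e) 0) ^ 2 + μ * Matrix.trace (eminus * eminus)) :
    Es = EsPlus + EsMinus := by
  subst hD he hDplus hDminus heplus heminus hEs hEsPlus hEsMinus
  simp only [trace_orthogonal_conj_diagonal_sq hV]
  rw [sq_eq_max_zero_sq_add_min_zero_sq (Matrix.trace _),
    Finset.sum_congr rfl fun i _ => sq_eq_max_zero_sq_add_min_zero_sq (lam i),
    Finset.sum_add_distrib]
  ring
end
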